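/- Let G(z) = ((z-1)/z)^2 and Q = θ/(z(z-1)) dz^2 with θ ∈ ℂ \ {0}. Consider u'' + r u = 0 with r dz^2 = S(G)/2 + Q. Then at both z = 0 and z = 1, the indicial equation has roots -1/2 and 3/2, and the log-term coefficients at z = 0 and z = 1 both vanish if and only if θ = -2. -/

import Mathlib

/-- The Schwarzian derivative S(f) = (f''/f')' - (1/2)(f''/f')². -/
noncomputable def schwarzian (f : ℂ → ℂ) (z : ℂ) : ℂ :=
  deriv (fun w => deriv (deriv f) w / deriv f w) z
    - (1 / 2) * (deriv (deriv f) z / deriv f z) ^ 2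

lemma G_deriv1 (z : ℂ) (h0 : z ≠ 0) :
    deriv (fun w : ℂ => ((w - 1) / w) ^ 2) z = 2 * (z - 1) / z ^ 3 := by
  have h := ((((hasDerivAt_id z).sub_const 1).div (hasDerivAt_id z) h0).pow 2)
  refine HasDerivAt.deriv (h.congr_deriv ?_)
  simp
  field_simp

lemma G_deriv2 (z : ℂ) (h0 : z ≠ 0) :
    deriv (deriv (fun w : ℂ => ((w - 1) / w) ^ 2)) z = (6 - 4 * z) / z ^ 4 := by
  have he : deriv (fun w : ℂ => ((w - 1) / w) ^ 2) =ᶠ[nhds z]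
      fun w => 2 * (w - 1) / w ^ 3 := by
    filter_upwards [isOpen_ne.mem_nhds h0] with w hw
    exact G_deriv1 w hw
  rw [he.deriv_eq]
  have h := (((hasDerivAt_id z).sub_const 1).const_mul 2).div
    ((hasDerivAt_id z).pow 3) (pow_ne_zero 3 h0)
  refine HasDerivAt.deriv (h.congr_deriv ?_)
  simp
  field_simp
  ring

lemma G_schwarzian (z : ℂ) (h0 : z ≠ 0) (h1 : z ≠ 1) :
    schwarzian (fun w => ((w - 1) / w) ^ 2) z = -3 / (2 * z ^ 2 * (z - 1) ^ 2) := by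
  have h1' : z - 1 ≠ 0 := sub_ne_zero.mpr h1
  unfold schwarzian
  have he : (fun w => deriv (deriv (fun w : ℂ => ((w - 1) / w) ^ 2)) w /
      deriv (fun w : ℂ => ((w - 1) / w) ^ 2) w) =ᶠ[nhds z]
      fun w => (3 - 2 * w) / (w * (w - 1)) := by
    filter_upwards [isOpen_ne.mem_nhds h0, isOpen_ne.mem_nhds h1] with w hw hw1
    have hw0 : w ≠ 0 := hw
    have hw1' : w - 1 ≠ 0 := sub_ne_zero.mpr hw1
    rw [G_deriv1 w hw, G_deriv2 w hw]
    field_simp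
    ring
  have hd : deriv (fun w : ℂ => (3 - 2 * w) / (w * (w - 1))) z =
      (-2 * (z * (z - 1)) - (3 - 2 * z) * (2 * z - 1)) / (z * (z - 1)) ^ 2 := by
    have h := (((hasDerivAt_id z).const_mul 2).const_sub 3).div
      ((hasDerivAt_id z).mul ((hasDerivAt_id z).sub_const 1)) (mul_ne_zero h0 h1')
    refine HasDerivAt.deriv (h.congr_deriv ?_)
    simp
    ring
  rw [he.deriv_eq, hd, he.eq_of_nhds]
  field_simp
  ring

/-- For G = ((z-1)/z)², Q = θ/(z(z-1)) dz², r = S(G)/2 + Q: at both z = 0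
and z = 1 the indicial equation of u'' + r u = 0 has roots -1/2 and 3/2 (i.e. q₀ = -3/4),
with expansions z²r(z) = -3/4 + q₁z + q₂z² + ... at each point, and the two log-term
coefficients (criterion q₂ + q₁² = 0 for m = 2) both vanish iff θ = -2. -/
theorem type_O112_logterm (θ : ℂ) (hθ : θ ≠ 0)
    (r : ℂ → ℂ)
    (hr : ∀ z : ℂ, z ≠ 0 → z ≠ 1 →
      r z = schwarzian (fun w => ((w - 1) / w) ^ 2) z / 2 + θ / (z * (z - 1))) :
    ((3 / 2 : ℂ) * (3 / 2 - 1) + (-3 / 4) = 0 ∧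
     (-1 / 2 : ℂ) * (-1 / 2 - 1) + (-3 / 4) = 0) ∧
    (∃ h0 h1 : ℂ → ℂ, AnalyticAt ℂ h0 0 ∧ AnalyticAt ℂ h1 0 ∧
      (∀ᶠ z in nhdsWithin (0 : ℂ) {(0 : ℂ)}ᶜ,
        z ^ 2 * r z = -3 / 4 + (-3 / 2 - θ) * z + z ^ 2 * h0 z) ∧
      (∀ᶠ w in nhdsWithin (0 : ℂ) {(0 : ℂ)}ᶜ,
        w ^ 2 * r (1 + w) = -3 / 4 + (3 / 2 + θ) * w + w ^ 2 * h1 w) ∧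
      ((h0 0 + (-3 / 2 - θ) ^ 2 = 0 ∧ h1 0 + (3 / 2 + θ) ^ 2 = 0) ↔ θ = -2)) := by
  refine ⟨by norm_num, fun z => -3 / 4 * (3 - 2 * z) / (1 - z) ^ 2 - θ / (1 - z),
    fun w => -3 / 4 * (3 + 2 * w) / (1 + w) ^ 2 - θ / (1 + w), ?_, ?_, ?_, ?_, ?_⟩
  · fun_prop (disch := norm_num)
  · fun_prop (disch := norm_num)
  · have hn : ∀ᶠ z : ℂ in nhdsWithin (0 : ℂ) {(0 : ℂ)}ᶜ, z ≠ 1 :=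
      nhdsWithin_le_nhds (isOpen_ne.mem_nhds zero_ne_one)
    filter_upwards [hn, self_mem_nhdsWithin] with z hz1 hz0
    have hz0 : z ≠ 0 := hz0
    have h1 : z - 1 ≠ 0 := sub_ne_zero.mpr hz1
    have h2 : 1 - z = -(z - 1) := by ring
    rw [hr z hz0 hz1, G_schwarzian z hz0 hz1, h2]
    field_simp
    ring
  · have hn : ∀ᶠ z : ℂ in nhdsWithin (0 : ℂ) {(0 : ℂ)}ᶜ, z ≠ -1 :=
      nhdsWithin_le_nhds (isOpen_ne.mem_nhds (by norm_num))
    filter_upwards [hn, self_mem_nhdsWithin] with z hz1 hz0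
    have hz0 : z ≠ 0 := hz0
    have h1 : 1 + z ≠ 0 := fun h => hz1 (by linear_combination h)
    have h2 : 1 + z - 1 = z := by ring
    rw [hr (1 + z) h1 (by simpa using hz0), G_schwarzian (1 + z) h1 (by simpa using hz0), h2]
    field_simp
    ring
  · constructor
    · rintro ⟨h, -⟩
      have : θ * (θ + 2) = 0 := by
        norm_num at h
        linear_combination h
      rcases mul_eq_zero.mp this with h | h
      · exact absurd h hθ
      · linear_combination h
    · rintro rfl
      norm_num
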